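/- arXiv:2408.01518 — 2 statements merged into one kernel-verified Lean document; each statement's English description precedes it below -/
import Mathlib

section
/- Let I be an ideal of the polynomial ring R = ℤ[x₁,…,x_k] generated by a finite tuple F = (f₁,…,f_s) of nonzero elements. Then there exists a constant C > 0, depending only on F, with the following property: whenever g ∈ I and h₁,…,h_s ∈ R satisfy g = h₁f₁ + ⋯ + h_sf_s and Σᵢ|hᵢ| = area_{I,F}(g), then deg hᵢ ≤ deg g + C·area_{I,F}(g) for every i = 1,…,s. -/
/-- The norm `|g|` of a polynomial in `ℤ[x₁,…,x_k]`: the sum of the absolute values of its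
coefficients. -/
noncomputable def mnorm {k : ℕ} (g : MvPolynomial (Fin k) ℤ) : ℕ :=
  ∑ d ∈ g.support, (g.coeff d).natAbs

/-- The area of `g` with respect to the generating tuple `F`:
`area_{I,F}(g) = min { Σᵢ |hᵢ| : hᵢ ∈ R, g = Σᵢ hᵢ fᵢ }`. -/
noncomputable def marea {k s : ℕ} (F : Fin s → MvPolynomial (Fin k) ℤ)
    (g : MvPolynomial (Fin k) ℤ) : ℕ :=
  sInf {n : ℕ | ∃ h : Fin s → MvPolynomial (Fin k) ℤ,
    g = ∑ i, h i * F i ∧ n = ∑ i, mnorm (h i)}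

open MvPolynomial in
noncomputable def lowPart {k : ℕ} (t : ℕ) (p : MvPolynomial (Fin k) ℤ) : MvPolynomial (Fin k) ℤ :=
  ∑ d ∈ p.support with d.degree ≤ t, monomial d (p.coeff d)

lemma coeff_lowPart {k : ℕ} (t : ℕ) (p : MvPolynomial (Fin k) ℤ) (e : Fin k →₀ ℕ) :
    (lowPart t p).coeff e = if e.degree ≤ t then p.coeff e else 0 := by
  classical
  unfold lowPart
  rw [MvPolynomial.coeff_sum]
  simp only [MvPolynomial.coeff_monomial]
  rw [Finset.sum_ite_eq']
  by_cases h : e.degree ≤ t <;> by_cases h' : p.coeff e = 0 <;> simp [h, h']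

lemma support_lowPart {k : ℕ} (t : ℕ) (p : MvPolynomial (Fin k) ℤ) :
    (lowPart t p).support = p.support.filter (fun d => d.degree ≤ t) := by
  ext e
  simp only [MvPolynomial.mem_support_iff, coeff_lowPart, Finset.mem_filter]
  by_cases h : e.degree ≤ t <;> simp [h]

lemma mnorm_lowPart {k : ℕ} (t : ℕ) (p : MvPolynomial (Fin k) ℤ) :
    mnorm (lowPart t p) = ∑ d ∈ p.support with d.degree ≤ t, (p.coeff d).natAbs := by
  unfold mnorm
  rw [support_lowPart]
  refine Finset.sum_congr rfl fun d hd => ?_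
  rw [coeff_lowPart, if_pos (Finset.mem_filter.1 hd).2]

lemma mnorm_lowPart_le {k : ℕ} (t : ℕ) (p : MvPolynomial (Fin k) ℤ) :
    mnorm (lowPart t p) ≤ mnorm p := by
  rw [mnorm_lowPart]
  exact Finset.sum_le_sum_of_subset (Finset.filter_subset _ _)

lemma mnorm_lowPart_lt {k : ℕ} (t : ℕ) (p : MvPolynomial (Fin k) ℤ) (e : Fin k →₀ ℕ)
    (he : e ∈ p.support) (ht : t < e.degree) :
    mnorm (lowPart t p) < mnorm p := by
  rw [mnorm_lowPart]
  refine Finset.sum_lt_sum_of_subset (Finset.filter_subset _ _) he ?_ ?_ ?_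
  · simp [ht]
  · exact Int.natAbs_pos.2 (MvPolynomial.mem_support_iff.1 he)
  · intros; exact Nat.zero_le _

lemma card_support_le_mnorm {k : ℕ} (p : MvPolynomial (Fin k) ℤ) :
    p.support.card ≤ mnorm p := by
  unfold mnorm
  rw [Finset.card_eq_sum_ones]
  exact Finset.sum_le_sum fun d hd => Int.natAbs_pos.2 (MvPolynomial.mem_support_iff.1 hd)

lemma coeff_zero_of_lt {k : ℕ} (p : MvPolynomial (Fin k) ℤ) (e : Fin k →₀ ℕ)
    (h : p.totalDegree < e.degree) : p.coeff e = 0 := by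
  apply MvPolynomial.coeff_eq_zero_of_totalDegree_lt
  exact h

lemma degree_le_totalDegree' {k : ℕ} (p : MvPolynomial (Fin k) ℤ) (e : Fin k →₀ ℕ)
    (h : e ∈ p.support) : e.degree ≤ p.totalDegree := by
  by_contra hc
  exact MvPolynomial.mem_support_iff.1 h (coeff_zero_of_lt p e (not_le.1 hc))

lemma totalDegree_lowPart {k : ℕ} (t : ℕ) (p : MvPolynomial (Fin k) ℤ) :
    (lowPart t p).totalDegree ≤ t := by
  unfold MvPolynomial.totalDegree
  refine Finset.sup_le fun d hd => ?_
  rw [support_lowPart] at hd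
  exact (Finset.mem_filter.1 hd).2

lemma gap {S : Finset ℕ} {A G D m : ℕ} (hD : 0 < D) (hS : S.card ≤ A) (hm : m ∈ S)
    (hmA : G + D * A < m) : ∃ j < A, ∀ x ∈ S, ¬ (G + j * D < x ∧ x ≤ G + (j + 1) * D) := by
  by_contra! hc
  choose! f hf1 hf2 using hc
  have hle : ∀ j < A, f j ≤ G + D * A := fun j hj => by
    have : (j + 1) * D ≤ A * D := Nat.mul_le_mul_right _ hj
    have := (hf2 j hj).2
    nlinarith
  have hinj : Set.InjOn f (Finset.range A : Set ℕ) := by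
    intro a ha b hb hab
    simp only [Finset.coe_range, Set.mem_Iio] at ha hb
    have h1 := hf2 a ha
    have h2 := hf2 b hb
    rw [hab] at h1
    have h3 : a * D < (b + 1) * D := by omega
    have h4 : b * D < (a + 1) * D := by omega
    have := Nat.lt_of_mul_lt_mul_right h3
    have := Nat.lt_of_mul_lt_mul_right h4
    omega
  have hsub : insert m ((Finset.range A).image f) ⊆ S := by
    intro x hx
    simp only [Finset.mem_insert, Finset.mem_image, Finset.mem_range] at hx
    rcases hx with rfl | ⟨j, hj, rfl⟩
    · exact hm
    · exact hf1 j hj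
  have hc := Finset.card_le_card hsub
  rw [Finset.card_insert_of_notMem, Finset.card_image_of_injOn hinj, Finset.card_range] at hc
  · omega
  · simp only [Finset.mem_image, Finset.mem_range, not_exists, not_and]
    intro j hj he
    have := hle j hj
    omega

/-- Theorem A, polynomial case. If `I` is the ideal of `ℤ[x₁,…,x_k]`
generated by the tuple `F = (f₁,…,f_s)` of nonzero elements, then there is a constant
`C > 0` depending only on `F` such that any area-minimizing expression `g = Σᵢ hᵢ fᵢ` of an
element `g ∈ I` satisfies `deg hᵢ ≤ deg g + C ⬝ area_{I,F}(g)` for all `i`. -/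
theorem degree_bound_polynomial {k s : ℕ} (F : Fin s → MvPolynomial (Fin k) ℤ)
    (hF : ∀ i, F i ≠ 0)
    (I : Ideal (MvPolynomial (Fin k) ℤ)) (hI : I = Ideal.span (Set.range F)) :
    ∃ C : ℕ, 0 < C ∧
      ∀ g ∈ I, ∀ h : Fin s → MvPolynomial (Fin k) ℤ,
        g = ∑ i, h i * F i →
        (∑ i, mnorm (h i)) = marea F g →
        ∀ i, (h i).totalDegree ≤ g.totalDegree + C * marea F g := by
  classical
  refine ⟨(Finset.univ.sup fun i => (F i).totalDegree) + 1, Nat.succ_pos _, ?_⟩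
  set D := (Finset.univ.sup fun i => (F i).totalDegree) + 1 with hD
  have hFD : ∀ i, (F i).totalDegree ≤ D := fun i =>
    (Finset.le_sup (f := fun i => (F i).totalDegree) (Finset.mem_univ i)).trans (Nat.le_succ _)
  intro g _ h hg hA i
  by_contra! hlt
  have hne : (h i).support.Nonempty := by
    rw [Finset.nonempty_iff_ne_empty]
    intro h0
    rw [MvPolynomial.support_eq_empty] at h0
    simp [h0] at hlt
  obtain ⟨e, he, hemax⟩ := Finset.exists_mem_eq_sup _ hne (fun d => d.degree)
  have hdeg : (h i).totalDegree = e.degree := hemax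
  let S : Finset ℕ := Finset.univ.biUnion fun j => (h j).support.image (fun d => d.degree)
  have hScard : S.card ≤ marea F g := by
    rw [← hA]
    refine Finset.card_biUnion_le.trans (Finset.sum_le_sum fun j _ => ?_)
    exact Finset.card_image_le.trans (card_support_le_mnorm _)
  have hmem : ∀ j, ∀ d ∈ (h j).support, d.degree ∈ S := fun j d hd =>
    Finset.mem_biUnion.2 ⟨j, Finset.mem_univ _, Finset.mem_image_of_mem _ hd⟩
  obtain ⟨j, hj, hgap⟩ := gap (Nat.succ_pos _) hScard (hmem i e he) (hdeg ▸ hlt)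
  set t := g.totalDegree + j * D with ht
  have ht' : g.totalDegree + (j + 1) * D = t + D := by rw [ht]; ring
  have hte : t < e.degree := by
    have : j * D ≤ marea F g * D := Nat.mul_le_mul_right _ hj.le
    rw [← hdeg]
    nlinarith
  have hgl : g = ∑ l, lowPart t (h l) * F l := by
    ext c
    by_cases hc : c.degree ≤ t + D
    · conv_lhs => rw [hg]
      rw [MvPolynomial.coeff_sum, MvPolynomial.coeff_sum]
      refine Finset.sum_congr rfl fun l _ => ?_
      rw [MvPolynomial.coeff_mul, MvPolynomial.coeff_mul]
      refine Finset.sum_congr rfl fun x hx => ?_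
      congr 1
      rw [coeff_lowPart]
      split_ifs with hx1
      · rfl
      · by_contra h0
        refine hgap _ (hmem l x.1 (MvPolynomial.mem_support_iff.2 h0)) ⟨not_le.1 hx1, ?_⟩
        have : x.1.degree + x.2.degree = c.degree := by
          rw [← map_add, Finset.HasAntidiagonal.mem_antidiagonal.1 hx]
        change _ ≤ g.totalDegree + (j + 1) * D
        omega
    · rw [coeff_zero_of_lt g c (by omega), MvPolynomial.coeff_sum]
      symm
      refine Finset.sum_eq_zero fun l _ => coeff_zero_of_lt _ _ ?_
      have h1 := MvPolynomial.totalDegree_mul (lowPart t (h l)) (F l)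
      have h2 := totalDegree_lowPart t (h l)
      have h3 := hFD l
      omega
  have hle : marea F g ≤ ∑ l, mnorm (lowPart t (h l)) := Nat.sInf_le ⟨_, hgl, rfl⟩
  have hlt2 : ∑ l, mnorm (lowPart t (h l)) < ∑ l, mnorm (h l) :=
    Finset.sum_lt_sum (fun l _ => mnorm_lowPart_le _ _)
      ⟨i, Finset.mem_univ _, mnorm_lowPart_lt t _ e he hte⟩
  omega
end

section
/- Let I be an ideal of the polynomial ring R = ℤ[x₁,…,x_k] with finite generating tuple F = (f₁,…,f_s). Then there exists a constant C > 0 such that for all integers m, n ≥ 1 and every g ∈ I with |g| ≤ m and deg g ≤ n, one has area_{I,F}(g) ≤ C·m^{n^k}. -/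
section Norms
open MvPolynomial

/-- l1 norm relative to a norm on coefficients. -/
noncomputable def nrm {σ A : Type*} [CommRing A] (ν : A → ℕ) (p : MvPolynomial σ A) : ℕ :=
  ∑ d ∈ p.support, ν (p.coeff d)

structure IsNu {A : Type*} [CommRing A] (ν : A → ℕ) : Prop where
  zero : ν 0 = 0
  add : ∀ a b, ν (a + b) ≤ ν a + ν b
  mul : ∀ a b, ν (a * b) ≤ ν a * ν b
  neg : ∀ a, ν (-a) = ν a

theorem IsNu.sum {A ι : Type*} [CommRing A] {ν : A → ℕ} (h : IsNu ν) (s : Finset ι) (f : ι → A) :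
    ν (∑ i ∈ s, f i) ≤ ∑ i ∈ s, ν (f i) := by
  classical
  induction s using Finset.induction_on with
  | empty => simp [h.zero]
  | insert a s ha ih =>
    rw [Finset.sum_insert ha, Finset.sum_insert ha]
    exact (h.add _ _).trans (by gcongr)

theorem nrm_eq {σ A : Type*} [CommRing A] {ν : A → ℕ} (h : IsNu ν) (p : MvPolynomial σ A)
    (S : Finset (σ →₀ ℕ)) (hS : p.support ⊆ S) : nrm ν p = ∑ d ∈ S, ν (p.coeff d) := by
  refine Finset.sum_subset hS ?_
  intro x _ hx
  rw [notMem_support_iff.mp hx, h.zero]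

theorem nrm_add {σ A : Type*} [CommRing A] {ν : A → ℕ} (h : IsNu ν) (p q : MvPolynomial σ A) :
    nrm ν (p + q) ≤ nrm ν p + nrm ν q := by
  classical
  rw [nrm_eq h (p + q) (p.support ∪ q.support) support_add,
    nrm_eq h p (p.support ∪ q.support) Finset.subset_union_left,
    nrm_eq h q (p.support ∪ q.support) Finset.subset_union_right, ← Finset.sum_add_distrib]
  exact Finset.sum_le_sum fun d _ => by rw [coeff_add]; exact h.add _ _

theorem nrm_zero {σ A : Type*} [CommRing A] (ν : A → ℕ) :
    nrm ν (0 : MvPolynomial σ A) = 0 := by simp [nrm]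

theorem nrm_neg {σ A : Type*} [CommRing A] {ν : A → ℕ} (h : IsNu ν) (p : MvPolynomial σ A) :
    nrm ν (-p) = nrm ν p := by
  simp only [nrm, support_neg, coeff_neg, h.neg]

theorem nrm_sum {σ A ι : Type*} [CommRing A] {ν : A → ℕ} (h : IsNu ν) (s : Finset ι)
    (f : ι → MvPolynomial σ A) :
    nrm ν (∑ i ∈ s, f i) ≤ ∑ i ∈ s, nrm ν (f i) := by
  classical
  induction s using Finset.induction_on with
  | empty => simp [nrm_zero]
  | insert a s ha ih =>
    rw [Finset.sum_insert ha, Finset.sum_insert ha]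
    exact (nrm_add h _ _).trans (by gcongr)

theorem nrm_monomial {σ A : Type*} [CommRing A] {ν : A → ℕ} (h : IsNu ν) (d : σ →₀ ℕ) (a : A) :
    nrm ν (monomial d a) = ν a := by
  classical
  rw [nrm_eq h _ {d} support_monomial_subset]
  simp

theorem nrm_coeff_le {σ A : Type*} [CommRing A] {ν : A → ℕ} (h : IsNu ν) (p : MvPolynomial σ A)
    (d : σ →₀ ℕ) : ν (p.coeff d) ≤ nrm ν p := by
  by_cases hd : d ∈ p.support
  · exact Finset.single_le_sum (f := fun d => ν (p.coeff d)) (fun _ _ => Nat.zero_le _) hd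
  · rw [notMem_support_iff.mp hd, h.zero]; exact Nat.zero_le _

theorem nrm_monomial_mul {σ A : Type*} [CommRing A] {ν : A → ℕ} (h : IsNu ν) (d : σ →₀ ℕ) (a : A)
    (p : MvPolynomial σ A) : nrm ν (monomial d a * p) ≤ ν a * nrm ν p := by
  conv_lhs => rw [p.as_sum, Finset.mul_sum]
  refine (nrm_sum h _ _).trans ?_
  rw [nrm, Finset.mul_sum]
  refine Finset.sum_le_sum fun e _ => ?_
  rw [monomial_mul, nrm_monomial h]
  exact h.mul _ _

theorem nrm_mul {σ A : Type*} [CommRing A] {ν : A → ℕ} (h : IsNu ν)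
    (p q : MvPolynomial σ A) : nrm ν (p * q) ≤ nrm ν p * nrm ν q := by
  conv_lhs => rw [p.as_sum, Finset.sum_mul]
  refine (nrm_sum h _ _).trans ?_
  conv_rhs => rw [nrm, Finset.sum_mul]
  exact Finset.sum_le_sum fun e _ => nrm_monomial_mul h _ _ _

theorem isNu_int : IsNu Int.natAbs :=
  ⟨rfl, Int.natAbs_add_le, fun a b => (Int.natAbs_mul a b).le, Int.natAbs_neg⟩

theorem mnorm_eq {k : ℕ} (g : MvPolynomial (Fin k) ℤ) : mnorm g = nrm Int.natAbs g := rfl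

end Norms

section PolyNorm
open Polynomial

noncomputable def pn (p : ℤ[X]) : ℕ := ∑ i ∈ p.support, (p.coeff i).natAbs

theorem pn_eq (p : ℤ[X]) (S : Finset ℕ) (hS : p.support ⊆ S) :
    pn p = ∑ d ∈ S, (p.coeff d).natAbs := by
  refine Finset.sum_subset hS ?_
  intro x _ hx
  rw [notMem_support_iff.mp hx]; rfl

theorem pn_range (p : ℤ[X]) (w : ℕ) (hw : p.natDegree ≤ w) :
    pn p = ∑ d ∈ Finset.range (w + 1), (p.coeff d).natAbs :=
  pn_eq p _ (fun i hi => Finset.mem_range.mpr (by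
    have := le_natDegree_of_mem_supp i hi; omega))

theorem pn_add (p q : ℤ[X]) : pn (p + q) ≤ pn p + pn q := by
  rw [pn_eq (p + q) (p.support ∪ q.support) support_add,
    pn_eq p (p.support ∪ q.support) Finset.subset_union_left,
    pn_eq q (p.support ∪ q.support) Finset.subset_union_right, ← Finset.sum_add_distrib]
  exact Finset.sum_le_sum fun d _ => by rw [coeff_add]; exact Int.natAbs_add_le _ _

theorem pn_zero : pn 0 = 0 := by simp [pn]

theorem pn_monomial (d : ℕ) (a : ℤ) : pn (monomial d a) = a.natAbs := by
  rw [pn_eq _ {d} (support_monomial_subset d a)]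
  simp

theorem pn_sum {ι : Type*} (s : Finset ι) (f : ι → ℤ[X]) :
    pn (∑ i ∈ s, f i) ≤ ∑ i ∈ s, pn (f i) := by
  classical
  induction s using Finset.induction_on with
  | empty => simp [pn_zero]
  | insert a s ha ih =>
    rw [Finset.sum_insert ha, Finset.sum_insert ha]
    exact (pn_add _ _).trans (by gcongr)

theorem pn_monomial_mul (d : ℕ) (a : ℤ) (p : ℤ[X]) :
    pn (monomial d a * p) ≤ a.natAbs * pn p := by
  conv_lhs => rw [p.as_sum_support, Finset.mul_sum]
  refine (pn_sum _ _).trans ?_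
  rw [pn, Finset.mul_sum]
  refine Finset.sum_le_sum fun e _ => ?_
  rw [monomial_mul_monomial, pn_monomial, Int.natAbs_mul]

theorem pn_mul (p q : ℤ[X]) : pn (p * q) ≤ pn p * pn q := by
  conv_lhs => rw [p.as_sum_support, Finset.sum_mul]
  refine (pn_sum _ _).trans ?_
  conv_rhs => rw [pn, Finset.sum_mul]
  exact Finset.sum_le_sum fun e _ => pn_monomial_mul _ _ _

theorem isNu_pn : IsNu pn :=
  ⟨pn_zero, pn_add, pn_mul, fun a => by simp [pn]⟩

theorem pn_pos {p : ℤ[X]} (hp : p ≠ 0) : 1 ≤ pn p := by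
  have h1 : (p.coeff p.natDegree).natAbs ≤ pn p :=
    Finset.single_le_sum (f := fun d => (p.coeff d).natAbs) (fun _ _ => Nat.zero_le _)
      (natDegree_mem_support_of_nonzero hp)
  have : p.coeff p.natDegree ≠ 0 := by simpa using hp
  omega

/-- complex truncated norm -/
noncomputable def cS (w : ℕ) (p : ℂ[X]) : ℝ := ∑ i ∈ Finset.range (w + 1), ‖p.coeff i‖

theorem cdiv_lin (α : ℂ) (h g : ℂ[X]) (w : ℕ) (hg : (X - C α) * h = g) (hw : g.natDegree ≤ w) :
    cS w h ≤ (w + 1 : ℕ) * cS w g := by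
  have hhw : h.natDegree ≤ w := by
    by_cases h0 : h = 0
    · simp [h0]
    rw [← hg, natDegree_mul (X_sub_C_ne_zero α) h0] at hw
    omega
  have key : ∀ j, ‖h.coeff j‖ ≤ cS w g := by
    have hc : ∀ j, g.coeff (j + 1) = h.coeff j - α * h.coeff (j + 1) := by
      intro j
      rw [← hg, sub_mul, coeff_sub, coeff_X_mul, coeff_C_mul]
    have hS : ∑ i ∈ Finset.range (w + 2), ‖g.coeff i‖ = cS w g := by
      rw [Finset.sum_range_succ, coeff_eq_zero_of_natDegree_lt (by omega : g.natDegree < w + 1)]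
      simp [cS]
    rcases le_or_gt ‖α‖ 1 with ha | ha
    · have : ∀ t j, j + t = w + 1 →
          ‖h.coeff j‖ ≤ ∑ i ∈ Finset.Ico (j + 1) (w + 2), ‖g.coeff i‖ := by
        intro t
        induction t with
        | zero =>
          intro j hj
          rw [coeff_eq_zero_of_natDegree_lt (by omega), norm_zero]
          positivity
        | succ t ih =>
          intro j hj
          have h1 := ih (j + 1) (by omega)
          have h2 : h.coeff j = g.coeff (j + 1) + α * h.coeff (j + 1) := by rw [hc]; ring
          have h5 : ‖α * h.coeff (j + 1)‖ ≤ ‖h.coeff (j + 1)‖ := by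
            rw [norm_mul]; nlinarith [norm_nonneg (h.coeff (j + 1))]
          rw [Finset.sum_eq_sum_Ico_succ_bot (by omega), h2]
          exact (norm_add_le _ _).trans (by linarith)
      intro j
      rcases le_or_gt j w with hj | hj
      · refine (this (w + 1 - j) j (by omega)).trans ?_
        rw [← hS]
        refine Finset.sum_le_sum_of_subset_of_nonneg ?_ (fun _ _ _ => norm_nonneg _)
        intro i hi
        simp at hi ⊢; omega
      · rw [coeff_eq_zero_of_natDegree_lt (by omega), norm_zero]
        unfold cS; positivity
    · have h0 : ∀ j, ‖h.coeff j‖ ≤ ∑ i ∈ Finset.range (j + 1), ‖g.coeff i‖ := by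
        intro j
        induction j with
        | zero =>
          have : g.coeff 0 = - (α * h.coeff 0) := by
            rw [← hg, sub_mul, coeff_sub, coeff_X_mul_zero, coeff_C_mul]; ring
          simp only [zero_add, Finset.range_one, Finset.sum_singleton]
          rw [this, norm_neg, norm_mul]
          nlinarith [norm_nonneg (h.coeff 0)]
        | succ j ih =>
          rw [Finset.sum_range_succ]
          have h2 : α * h.coeff (j + 1) = h.coeff j - g.coeff (j + 1) := by rw [hc]; ring
          have h3 : ‖α * h.coeff (j + 1)‖ ≤ ‖h.coeff j‖ + ‖g.coeff (j + 1)‖ := by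
            rw [h2]; exact norm_sub_le _ _
          rw [norm_mul] at h3
          nlinarith [norm_nonneg (h.coeff (j + 1))]
      intro j
      rcases le_or_gt j w with hj | hj
      · refine (h0 j).trans ?_
        refine Finset.sum_le_sum_of_subset_of_nonneg ?_ (fun _ _ _ => norm_nonneg _)
        intro i hi
        simp at hi ⊢; omega
      · rw [coeff_eq_zero_of_natDegree_lt (by omega), norm_zero]
        unfold cS; positivity
  calc cS w h ≤ ∑ i ∈ Finset.range (w + 1), cS w g := Finset.sum_le_sum fun i _ => key i
    _ = _ := by simp

theorem cdiv_prod (s : Multiset ℂ) (w : ℕ) : ∀ (h g : ℂ[X]),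
    (s.map (fun a => X - C a)).prod * h = g → g.natDegree ≤ w →
    cS w h ≤ ((w + 1 : ℕ) : ℝ) ^ s.card * cS w g := by
  induction s using Multiset.induction_on with
  | empty => intro h g hg _; simp at hg; simp [hg]
  | cons a s ih =>
    intro h g hg hw
    rw [Multiset.map_cons, Multiset.prod_cons, mul_assoc] at hg
    have h1 := cdiv_lin a _ g w hg hw
    have hd : ((s.map (fun a => X - C a)).prod * h).natDegree ≤ w := by
      by_cases h0 : (s.map (fun a => X - C a)).prod * h = 0
      · simp [h0]
      rw [← hg, natDegree_mul (X_sub_C_ne_zero a) h0] at hw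
      omega
    have h2 := ih h _ rfl hd
    rw [Multiset.card_cons, pow_succ, mul_assoc]
    exact h2.trans (by gcongr)

theorem int_div_bound (f : ℤ[X]) (hf : f ≠ 0) (h g : ℤ[X]) (w : ℕ) (hg : f * h = g)
    (hw : g.natDegree ≤ w) : pn h ≤ (w + 1) ^ f.natDegree * pn g := by
  have hinj : Function.Injective (Int.castRingHom ℂ) := Int.cast_injective
  have conv : ∀ p : ℤ[X], p.natDegree ≤ w → cS w (p.map (Int.castRingHom ℂ)) = (pn p : ℝ) := by
    intro p hp
    rw [pn_range p w hp, cS]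
    push_cast
    refine Finset.sum_congr rfl fun i _ => ?_
    rw [coeff_map]
    simp
  have hhw : h.natDegree ≤ w := by
    by_cases h0 : h = 0
    · simp [h0]
    rw [← hg, natDegree_mul hf h0] at hw
    omega
  set fc := f.map (Int.castRingHom ℂ) with hfc
  have hs := IsAlgClosed.splits fc
  have e1 := hs.eq_prod_roots
  have hlc : fc.leadingCoeff = (f.leadingCoeff : ℂ) := by
    rw [hfc, leadingCoeff_map_of_injective hinj]; rfl
  have hcard : fc.roots.card = f.natDegree := by
    rw [← hs.natDegree_eq_card_roots, hfc, natDegree_map_eq_of_injective hinj]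
  have e2 : (fc.roots.map (fun a => X - C a)).prod * (C fc.leadingCoeff * h.map (Int.castRingHom ℂ))
      = g.map (Int.castRingHom ℂ) := by
    rw [← hg, Polynomial.map_mul, ← hfc]
    conv_rhs => rw [e1]
    ring
  have h1 := cdiv_prod fc.roots w _ _ e2 (natDegree_map_le.trans hw)
  rw [conv g hw, hcard] at h1
  have h2 : cS w (h.map (Int.castRingHom ℂ)) ≤
      cS w (C fc.leadingCoeff * h.map (Int.castRingHom ℂ)) := by
    refine Finset.sum_le_sum fun i _ => ?_
    rw [coeff_C_mul, norm_mul, hlc]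
    have : (1 : ℝ) ≤ ‖(f.leadingCoeff : ℂ)‖ := by
      rw [Complex.norm_intCast]
      exact_mod_cast Int.one_le_abs (by simpa using hf)
    nlinarith [norm_nonneg ((h.map (Int.castRingHom ℂ)).coeff i)]
  rw [conv h hhw] at h2
  exact_mod_cast h2.trans h1

end PolyNorm
section Base
open Polynomial

def PRep {ι : Type} [Fintype ι] (a : ι → ℤ[X]) (D N : ℕ) (g : ℤ[X]) : Prop :=
  ∃ h : ι → ℤ[X], g = ∑ i, h i * a i ∧ (∀ i, (h i).natDegree ≤ D) ∧ ∑ i, pn (h i) ≤ N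

theorem PRep.mono {ι : Type} [Fintype ι] {a : ι → ℤ[X]} {D N D' N' : ℕ} {g : ℤ[X]}
    (h : PRep a D N g) (hD : D ≤ D') (hN : N ≤ N') : PRep a D' N' g := by
  obtain ⟨h, h1, h2, h3⟩ := h
  exact ⟨h, h1, fun i => (h2 i).trans hD, h3.trans hN⟩

theorem PRep.add {ι : Type} [Fintype ι] {a : ι → ℤ[X]} {D N N' : ℕ} {g g' : ℤ[X]}
    (h : PRep a D N g) (h' : PRep a D N' g') : PRep a D (N + N') (g + g') := by
  obtain ⟨h, h1, h2, h3⟩ := h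
  obtain ⟨k, k1, k2, k3⟩ := h'
  refine ⟨fun i => h i + k i, ?_, fun i => ?_, ?_⟩
  · simp only [add_mul, Finset.sum_add_distrib, ← h1, ← k1]
  · exact (natDegree_add_le _ _).trans (max_le (h2 i) (k2 i))
  · refine (Finset.sum_le_sum fun i _ => pn_add _ _).trans ?_
    rw [Finset.sum_add_distrib]; omega

theorem PRep.mul {ι : Type} [Fintype ι] {a : ι → ℤ[X]} {D N D' : ℕ} {g : ℤ[X]}
    (h : PRep a D N g) (q : ℤ[X]) (hq : q.natDegree ≤ D') : PRep a (D' + D) (pn q * N) (q * g) := by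
  obtain ⟨h, h1, h2, h3⟩ := h
  refine ⟨fun i => q * h i, ?_, fun i => ?_, ?_⟩
  · rw [h1, Finset.mul_sum]
    exact Finset.sum_congr rfl fun i _ => by ring
  · exact natDegree_mul_le.trans (add_le_add hq (h2 i))
  · refine (Finset.sum_le_sum fun i _ => pn_mul _ _).trans ?_
    rw [← Finset.mul_sum]
    gcongr

theorem PRep.exists {ι : Type} [Fintype ι] (a : ι → ℤ[X]) (g : ℤ[X])
    (hg : g ∈ Ideal.span (Set.range a)) : ∃ E, PRep a E E g := by
  obtain ⟨h, hh⟩ := Ideal.mem_span_range_iff_exists_fun.mp hg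
  refine ⟨∑ i, (h i).natDegree + ∑ i, pn (h i), h, hh.symm, fun i => ?_, by omega⟩
  have := Finset.single_le_sum (f := fun i => (h i).natDegree) (fun _ _ => Nat.zero_le _)
    (Finset.mem_univ i)
  exact this.trans (Nat.le_add_right _ _)

theorem exists_qr (M : ℤ) (t : ℤ[X]) (w : ℕ) (hw : t.natDegree ≤ w) :
    ∃ q r : ℤ[X], t = C M * q + r ∧ q.natDegree ≤ w ∧ r.natDegree ≤ w ∧ pn q ≤ pn t ∧
      ∀ i, r.coeff i = t.coeff i % M := by
  set q : ℤ[X] := ∑ i ∈ Finset.range (w + 1), monomial i (t.coeff i / M) with hq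
  have hc : ∀ i, q.coeff i = t.coeff i / M := by
    intro i
    rw [hq, finsetSum_coeff]
    simp only [coeff_monomial]
    rw [Finset.sum_ite_eq']
    split_ifs with h
    · rfl
    · rw [coeff_eq_zero_of_natDegree_lt (by simp at h; omega)]; simp
  have hqw : q.natDegree ≤ w := by
    refine natDegree_le_iff_coeff_eq_zero.mpr fun i hi => ?_
    rw [hc, coeff_eq_zero_of_natDegree_lt (by omega)]; simp
  have hr : ∀ i, (t - C M * q).coeff i = t.coeff i % M := by
    intro i
    rw [coeff_sub, coeff_C_mul, hc, Int.emod_def]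
  refine ⟨q, t - C M * q, by ring, hqw, ?_, ?_, hr⟩
  · refine natDegree_le_iff_coeff_eq_zero.mpr fun i hi => ?_
    rw [hr, coeff_eq_zero_of_natDegree_lt (by omega)]; simp
  · rw [pn_range q w hqw, pn_range t w hw]
    refine Finset.sum_le_sum fun i _ => ?_
    rw [hc]
    exact Int.natAbs_ediv_le_natAbs _ _

theorem exists_common (I : Ideal ℤ[X]) (hI : I ≠ ⊥) :
    ∃ f : ℤ[X], f ≠ 0 ∧ ∃ M : ℤ, 0 < M ∧ (∀ g ∈ I, f ∣ g) ∧ f * C M ∈ I := by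
  classical
  obtain ⟨g0, hg0, hg0'⟩ := Submodule.exists_mem_ne_zero_of_ne_bot hI
  have hex : ∃ d, ∃ f ∈ I, f ≠ 0 ∧ f.natDegree = d := ⟨_, g0, hg0, hg0', rfl⟩
  obtain ⟨f0, hf0, hf0', hd⟩ := Nat.find_spec hex
  have hmin : ∀ g ∈ I, g ≠ 0 → f0.natDegree ≤ g.natDegree := by
    intro g hg hg'
    rw [hd]
    exact Nat.find_min' hex ⟨g, hg, hg', rfl⟩
  have hlc : f0.leadingCoeff ≠ 0 := by simpa using hf0'
  have key : ∀ d, ∀ g ∈ I, g.natDegree < d → f0.map (algebraMap ℤ ℚ) ∣ g.map (algebraMap ℤ ℚ) := by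
    intro d
    induction d with
    | zero => intro g _ h; omega
    | succ d ih =>
      intro g hg hgd
      by_cases h0 : g = 0
      · simp [h0]
      have hle := hmin g hg h0
      have hglc : g.leadingCoeff ≠ 0 := by simpa using h0
      set g' := C f0.leadingCoeff * g - C g.leadingCoeff * X ^ (g.natDegree - f0.natDegree) * f0
        with hg'
      have hg'I : g' ∈ I := I.sub_mem (I.mul_mem_left _ hg) (I.mul_mem_left _ hf0)
      have hdvd : f0.map (algebraMap ℤ ℚ) ∣ g'.map (algebraMap ℤ ℚ) := by
        by_cases hz : g' = 0
        · simp [hz]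
        refine ih g' hg'I ?_
        have h1 : g'.degree < (C f0.leadingCoeff * g).degree := by
          refine degree_sub_lt_left ?_ (mul_ne_zero (by simpa using hf0') h0) ?_
          · rw [degree_eq_natDegree (mul_ne_zero (by simpa using hf0') h0),
              degree_eq_natDegree (mul_ne_zero (mul_ne_zero (by simpa using h0)
                (pow_ne_zero _ X_ne_zero)) hf0'), natDegree_C_mul hlc, mul_assoc,
              natDegree_C_mul hglc, natDegree_mul (pow_ne_zero _ X_ne_zero) hf0', natDegree_X_pow]
            congr 1; omega
          · rw [leadingCoeff_mul, leadingCoeff_C, leadingCoeff_mul, leadingCoeff_mul, leadingCoeff_C,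
              leadingCoeff_X_pow, mul_one, mul_comm]
        rw [degree_C_mul hlc] at h1
        have := natDegree_lt_natDegree hz h1
        omega
      have e : C ((f0.leadingCoeff : ℤ) : ℚ) * g.map (algebraMap ℤ ℚ) = g'.map (algebraMap ℤ ℚ) +
          (C g.leadingCoeff * X ^ (g.natDegree - f0.natDegree)).map (algebraMap ℤ ℚ)
            * f0.map (algebraMap ℤ ℚ) := by
        rw [hg']
        simp [Polynomial.map_sub, Polynomial.map_mul]
      have h2 : f0.map (algebraMap ℤ ℚ) ∣ C ((f0.leadingCoeff : ℤ) : ℚ) * g.map (algebraMap ℤ ℚ) := by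
        rw [e]; exact dvd_add hdvd (dvd_mul_left _ _)
      have hu : IsUnit (C ((f0.leadingCoeff : ℤ) : ℚ)) :=
        isUnit_C.mpr (isUnit_iff_ne_zero.mpr (by exact_mod_cast hlc))
      exact (hu.dvd_mul_left).mp h2
  have hcont : f0.content ≠ 0 := by rwa [Ne, content_eq_zero_iff]
  refine ⟨f0.primPart, primPart_ne_zero _, |f0.content|, abs_pos.mpr hcont, ?_, ?_⟩
  · intro g hg
    refine (isPrimitive_primPart f0).dvd_of_fraction_map_dvd_fraction_map (K := ℚ) ?_
    refine dvd_trans ?_ (key _ g hg (Nat.lt_succ_self _))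
    exact Polynomial.map_dvd _ (Dvd.intro_left _ f0.eq_C_content_mul_primPart.symm)
  · have h1 : f0.primPart * C f0.content ∈ I := by
      rw [mul_comm, ← f0.eq_C_content_mul_primPart]; exact hf0
    rcases abs_choice f0.content with h | h <;> rw [h]
    · exact h1
    · simpa using I.neg_mem h1

theorem base_small {ι : Type} [Fintype ι] (a : ι → ℤ[X]) (f : ℤ[X]) (M : ℤ) (hM : 0 < M)
    (hfM : f * C M ∈ Ideal.span (Set.range a)) :
    ∃ c, ∀ w, ∀ r : ℤ[X], f * r ∈ Ideal.span (Set.range a) → r.natDegree ≤ w →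
      (∀ i, 0 ≤ r.coeff i ∧ r.coeff i < M) → PRep a (w + c) (c * (w + 1) ^ 2) (f * r) := by
  classical
  set I := Ideal.span (Set.range a) with hI
  let J : Ideal ℤ[X] := Submodule.comap (LinearMap.mulLeft ℤ[X] f) I
  have hJ : ∀ p, p ∈ J ↔ f * p ∈ I := fun p => Iff.rfl
  have hMJ : C M ∈ J := hfM
  have hL : ∀ j x, x ∈ J.leadingCoeffNth j ↔ ∃ p ∈ J, p.natDegree ≤ j ∧ p.coeff j = x := by
    intro j x
    simp only [Ideal.leadingCoeffNth, Submodule.mem_map, Ideal.degreeLE, Submodule.mem_inf,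
      mem_degreeLE, lcoeff_apply, natDegree_le_iff_degree_le]
    constructor
    · rintro ⟨p, ⟨h1, h2⟩, h3⟩; exact ⟨p, h2, h1, h3⟩
    · rintro ⟨p, h2, h1, h3⟩; exact ⟨p, ⟨h1, h2⟩, h3⟩
  obtain ⟨d0, hd0⟩ := (monotone_stabilizes_iff_noetherian.mpr
    (inferInstance : IsNoetherian ℤ ℤ)) ⟨fun j => J.leadingCoeffNth j,
      fun i j hij => Ideal.leadingCoeffNth_mono J hij⟩
  let T : Set ℤ[X] := {p | p ∈ J ∧ p.natDegree ≤ d0 ∧ ∀ i, 0 ≤ p.coeff i ∧ p.coeff i < M}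
  have hT : T.Finite := by
    refine Set.Finite.of_finite_image (f := fun (p : ℤ[X]) (i : Fin (d0 + 1)) => p.coeff i) ?_ ?_
    · refine (Set.Finite.pi' (fun _ : Fin (d0 + 1) => Set.finite_Ico (0 : ℤ) M)).subset ?_
      rintro _ ⟨p, hp, rfl⟩ i
      exact hp.2.2 i
    · intro p hp q hq hpq
      ext i
      by_cases hi : i ≤ d0
      · exact congrFun hpq ⟨i, by omega⟩
      · rw [coeff_eq_zero_of_natDegree_lt (by have := hp.2.1; omega),
          coeff_eq_zero_of_natDegree_lt (by have := hq.2.1; omega)]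
  have hE : ∀ p : ℤ[X], ∃ E, p ∈ J → PRep a E E (f * p) := by
    intro p
    by_cases hp : p ∈ J
    · obtain ⟨E, h⟩ := PRep.exists a (f * p) hp
      exact ⟨E, fun _ => h⟩
    · exact ⟨0, fun h => absurd h hp⟩
  choose E hE using hE
  obtain ⟨c0, hc0⟩ := (hT.image E).bddAbove
  have hc0 : ∀ p ∈ T, PRep a c0 c0 (f * p) := fun p hp =>
    (hE p hp.1).mono (hc0 ⟨p, hp, rfl⟩) (hc0 ⟨p, hp, rfl⟩)
  obtain ⟨K, hK⟩ := PRep.exists a _ hfM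
  obtain ⟨m, rfl⟩ := Int.eq_ofNat_of_zero_le hM.le
  have hmod : ∀ (t : ℤ[X]) i, 0 ≤ t.coeff i % (m : ℤ) ∧ t.coeff i % (m : ℤ) < m := fun t i =>
    ⟨Int.emod_nonneg _ hM.ne', Int.emod_lt_of_pos _ hM⟩
  refine ⟨c0 + K + m * K, ?_⟩
  intro w
  induction w with
  | zero =>
    intro r hr hrw hrc
    refine (hc0 r ⟨hr, by omega, hrc⟩).mono (by omega) (by simp; omega)
  | succ w ih =>
    intro r hr hrw hrc
    by_cases hwd : w + 1 ≤ d0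
    · refine (hc0 r ⟨hr, by omega, hrc⟩).mono (by omega) ?_
      calc c0 ≤ c0 + K + m * K := by omega
        _ ≤ _ := Nat.le_mul_of_pos_right _ (by positivity)
    have hmem : r.coeff (w + 1) ∈ J.leadingCoeffNth d0 := by
      have := hd0 (w + 1) (by omega)
      change J.leadingCoeffNth d0 = J.leadingCoeffNth (w + 1) at this
      rw [this, hL]
      exact ⟨r, hr, hrw, rfl⟩
    obtain ⟨p, hpJ, hpd, hpc⟩ := (hL _ _).mp hmem
    obtain ⟨q0, p', hp', -, hp'd, -, hp'c⟩ := exists_qr m p d0 hpd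
    have hp'J : p' ∈ J := by
      have : p' = p - C (m : ℤ) * q0 := by rw [hp']; ring
      rw [this]
      exact J.sub_mem hpJ (J.mul_mem_right _ hMJ)
    have hp'T : p' ∈ T := ⟨hp'J, hp'd, fun i => by rw [hp'c]; exact hmod _ _⟩
    set t := r - X ^ (w + 1 - d0) * p' with ht
    have htJ : t ∈ J := J.sub_mem hr (J.mul_mem_left _ hp'J)
    have htd : t.natDegree ≤ w := by
      refine natDegree_le_iff_coeff_eq_zero.mpr fun i hi => ?_
      rw [ht, coeff_sub, coeff_X_pow_mul']
      rw [if_pos (by omega)]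
      by_cases hi' : i = w + 1
      · subst hi'
        have : w + 1 - (w + 1 - d0) = d0 := by omega
        rw [this, hp'c, hpc, Int.emod_eq_of_lt (hrc _).1 (hrc _).2, sub_self]
      · rw [coeff_eq_zero_of_natDegree_lt (by omega),
          coeff_eq_zero_of_natDegree_lt (by omega), sub_zero]
    have htn : pn t ≤ m * (w + 1) := by
      rw [pn_range t w htd]
      calc _ ≤ ∑ i ∈ Finset.range (w + 1), m := by
            refine Finset.sum_le_sum fun i _ => ?_
            rw [ht, coeff_sub, coeff_X_pow_mul']
            have h1 := hrc i
            have h2 := hp'T.2.2 (i - (w + 1 - d0))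
            split_ifs <;> omega
        _ = _ := by simp [mul_comm]
    obtain ⟨q, r', hqr, hqd, hr'd, hqn, hr'c⟩ := exists_qr m t w htd
    have hr'J : r' ∈ J := by
      have : r' = t - C (m : ℤ) * q := by rw [hqr]; ring
      rw [this]
      exact J.sub_mem htJ (J.mul_mem_right _ hMJ)
    have h1 := ih r' hr'J hr'd (fun i => by rw [hr'c]; exact hmod _ _)
    have h2 := hK.mul q hqd
    have h3 := (hc0 p' hp'T).mul (X ^ (w + 1 - d0)) (natDegree_X_pow _).le
    have hX : pn (X ^ (w + 1 - d0) : ℤ[X]) = 1 := by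
      rw [← monomial_one_right_eq_X_pow, pn_monomial]; rfl
    rw [hX, one_mul] at h3
    have e : f * r = X ^ (w + 1 - d0) * (f * p') + q * (f * C (m : ℤ)) + f * r' := by
      have : r = t + X ^ (w + 1 - d0) * p' := by rw [ht]; ring
      rw [this, hqr]; ring
    rw [e]
    refine ((((h3.mono (D' := w + 1 + (c0 + K + m * K)) ?_ le_rfl).add
      (h2.mono ?_ le_rfl)).add (h1.mono ?_ le_rfl))).mono le_rfl ?_
    · have := Nat.zero_le (m * K); omega
    · have := Nat.zero_le (m * K); omega
    · omega
    · have : pn q * K ≤ m * (w + 1) * K := by gcongr; omega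
      nlinarith [Nat.zero_le (m * K), Nat.zero_le (m * K * w), Nat.zero_le ((c0 + K) * w)]

theorem base {ι : Type} [Fintype ι] (a : ι → ℤ[X]) :
    ∃ c, ∀ w, ∀ g ∈ Ideal.span (Set.range a), g.natDegree ≤ w →
      PRep a (w + c) ((w + 2) ^ c * pn g) g := by
  by_cases hI : Ideal.span (Set.range a) = ⊥
  · refine ⟨0, fun w g hg _ => ?_⟩
    rw [hI, Ideal.mem_bot] at hg
    exact ⟨fun _ => 0, by simp [hg], by simp, by simp [pn_zero]⟩
  obtain ⟨f, hf, M, hM, hdvd, hfM⟩ := exists_common _ hI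
  obtain ⟨c, hc⟩ := base_small a f M hM hfM
  obtain ⟨K, hK⟩ := PRep.exists a _ hfM
  refine ⟨f.natDegree + 2 + K + c, fun w g hg hw => ?_⟩
  by_cases hg0 : g = 0
  · exact ⟨fun _ => 0, by simp [hg0], by simp, by simp [pn_zero]⟩
  have hg1 := pn_pos hg0
  obtain ⟨h, rfl⟩ := hdvd g hg
  have hn := int_div_bound f hf h _ w rfl hw
  have hhw : h.natDegree ≤ w := by
    rw [natDegree_mul hf (right_ne_zero_of_mul hg0)] at hw
    omega
  obtain ⟨q, r, hqr, hqd, hrd, hqn, hrc⟩ := exists_qr M h w hhw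
  have e : f * h = q * (f * C M) + f * r := by
    rw [hqr]; ring
  have hr : f * r ∈ Ideal.span (Set.range a) := by
    have : f * r = f * h - q * (f * C M) := by rw [e]; ring
    rw [this]
    exact Ideal.sub_mem _ hg (Ideal.mul_mem_left _ _ hfM)
  have h1 := hc w r hr hrd (fun i => by
    rw [hrc]; exact ⟨Int.emod_nonneg _ hM.ne', Int.emod_lt_of_pos _ hM⟩)
  have h2 := hK.mul q hqd
  rw [show PRep a (w + (f.natDegree + 2 + K + c)) ((w + 2) ^ (f.natDegree + 2 + K + c) * pn (f * h))
    (f * h) ↔ PRep a (w + (f.natDegree + 2 + K + c))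
      ((w + 2) ^ (f.natDegree + 2 + K + c) * pn (f * h)) (q * (f * C M) + f * r) by rw [← e]]
  refine ((h2.mono (by omega) le_rfl).add (h1.mono (by omega) le_rfl)).mono le_rfl ?_
  set P := pn (f * h)
  set A := (w + 2) ^ f.natDegree with hA
  have hA1 : 1 ≤ A := Nat.one_le_pow _ _ (by omega)
  have hA2 : (w + 1) ^ f.natDegree ≤ A := Nat.pow_le_pow_left (by omega) _
  have hKc : K + c ≤ (w + 2) ^ (K + c) :=
    (Nat.lt_two_pow_self).le.trans (Nat.pow_le_pow_left (by omega) _)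
  have hB1 : 1 ≤ (w + 2) ^ 2 := Nat.one_le_pow _ _ (by omega)
  have hB2 : (w + 1) ^ 2 ≤ (w + 2) ^ 2 := Nat.pow_le_pow_left (by omega) _
  calc pn q * K + c * (w + 1) ^ 2 ≤ (A * P) * K + c * (w + 2) ^ 2 := by
        gcongr
        exact hqn.trans (hn.trans (by gcongr))
    _ ≤ (A * P) * K * (w + 2) ^ 2 + c * (w + 2) ^ 2 * (A * P) := by
        exact add_le_add (Nat.le_mul_of_pos_right _ hB1)
          (Nat.le_mul_of_pos_right _ (Nat.mul_pos hA1 hg1))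
    _ = A * (w + 2) ^ 2 * (K + c) * P := by ring
    _ ≤ A * (w + 2) ^ 2 * (w + 2) ^ (K + c) * P := by gcongr
    _ = _ := by rw [hA]; ring

end Base
section Main
open MvPolynomial

theorem groebner {k : ℕ} {A : Type} [CommRing A] [IsNoetherianRing A]
    (I : Ideal (MvPolynomial (Fin k) A)) :
    ∃ (ι : Type) (_ : Fintype ι) (v : ι → Fin k →₀ ℕ) (p : ι → MvPolynomial (Fin k) A),
      (∀ i, p i ∈ I ∧ ∀ d ∈ (p i).support, MonomialOrder.degLex.toSyn d ≤
        MonomialOrder.degLex.toSyn (v i)) ∧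
      ∀ g ∈ I, ∀ u, (∀ d ∈ g.support, MonomialOrder.degLex.toSyn d ≤
        MonomialOrder.degLex.toSyn u) →
        g.coeff u ∈ Ideal.span (Set.range fun i => if v i ≤ u then (p i).coeff (v i) else 0) := by
  classical
  let S : Set (MvPolynomial (Fin k) A) := {q | ∃ u, ∃ g ∈ I,
    (∀ d ∈ g.support, MonomialOrder.degLex.toSyn d ≤ MonomialOrder.degLex.toSyn u) ∧
    q = monomial u (g.coeff u)}
  obtain ⟨s', hs', hspan⟩ := (Submodule.fg_span_iff_fg_span_finset_subset S).mp
    (IsNoetherian.noetherian (Submodule.span (MvPolynomial (Fin k) A) S))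
  have hch : ∀ i : s', ∃ u, ∃ g ∈ I,
    (∀ d ∈ g.support, MonomialOrder.degLex.toSyn d ≤ MonomialOrder.degLex.toSyn u) ∧
    (i : MvPolynomial (Fin k) A) = monomial u (g.coeff u) := fun i => hs' i.2
  choose v p hpI hps hpe using hch
  refine ⟨s', inferInstance, v, p, fun i => ⟨hpI i, hps i⟩, ?_⟩
  intro g hg u hu
  have h1 : monomial u (g.coeff u) ∈ Submodule.span (MvPolynomial (Fin k) A) S :=
    Submodule.subset_span ⟨u, g, hg, hu, rfl⟩
  rw [hspan] at h1
  have h2 : monomial u (g.coeff u) ∈ Ideal.span (Set.range fun i : s' =>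
      (i : MvPolynomial (Fin k) A)) := by
    rw [Subtype.range_coe_subtype]; exact h1
  obtain ⟨c, hc⟩ := Ideal.mem_span_range_iff_exists_fun.mp h2
  refine Ideal.mem_span_range_iff_exists_fun.mpr ⟨fun i => (c i).coeff (u - v i), ?_⟩
  have h3 := congrArg (coeff u) hc
  rw [coeff_sum, coeff_monomial, if_pos rfl] at h3
  rw [← h3]
  refine Finset.sum_congr rfl fun i _ => ?_
  rw [hpe i, coeff_mul_monomial']
  split_ifs <;> simp

theorem main_alg {k : ℕ} (I : Ideal (MvPolynomial (Fin k) (Polynomial ℤ))) :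
    ∃ (ι : Type) (_ : Fintype ι) (p : ι → MvPolynomial (Fin k) (Polynomial ℤ)),
      (∀ i, p i ∈ I) ∧ ∃ c : ℕ, ∀ W s : ℕ, ∀ B : Finset (Fin k →₀ ℕ), B.card = s →
        (∀ u ∈ B, ∀ d, MonomialOrder.degLex.toSyn d ≤ MonomialOrder.degLex.toSyn u → d ∈ B) →
        ∀ w g, w + s * c ≤ W → g ∈ I → g.support ⊆ B → (∀ d, (g.coeff d).natDegree ≤ w) →
        ∃ H : ι → MvPolynomial (Fin k) (Polynomial ℤ), g = ∑ i, H i * p i ∧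
          ∑ i, nrm pn (H i) ≤ (1 + (W + 2) ^ c * c) ^ s * nrm pn g := by
  classical
  obtain ⟨ι, hι, v, p, hp, hlead⟩ := groebner I
  refine ⟨ι, hι, p, fun i => (hp i).1, ?_⟩
  have hb : ∀ T : Finset ι, ∃ c, ∀ w, ∀ g ∈ Ideal.span (Set.range
      (fun i => if i ∈ T then (p i).coeff (v i) else 0)), g.natDegree ≤ w →
      PRep (fun i => if i ∈ T then (p i).coeff (v i) else 0) (w + c) ((w + 2) ^ c * pn g) g :=
    fun T => base _
  choose cT hcT using hb
  obtain ⟨c0, hc0⟩ : ∃ c0, ∀ T, cT T ≤ c0 :=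
    ⟨∑ T, cT T, fun T => Finset.single_le_sum (f := cT) (fun _ _ => Nat.zero_le _)
      (Finset.mem_univ T)⟩
  obtain ⟨P, hP⟩ : ∃ P, ∀ i, nrm pn (p i) ≤ P :=
    ⟨∑ i, nrm pn (p i), fun T => Finset.single_le_sum (f := fun i => nrm pn (p i))
      (fun _ _ => Nat.zero_le _) (Finset.mem_univ T)⟩
  obtain ⟨E, hE⟩ : ∃ E, ∀ i d, ((p i).coeff d).natDegree ≤ E := by
    refine ⟨∑ i, ∑ d ∈ (p i).support, ((p i).coeff d).natDegree, fun i d => ?_⟩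
    by_cases hd : d ∈ (p i).support
    · exact (Finset.single_le_sum (f := fun d => ((p i).coeff d).natDegree)
        (fun _ _ => Nat.zero_le _) hd).trans
        (Finset.single_le_sum (f := fun i => ∑ d ∈ (p i).support, ((p i).coeff d).natDegree)
        (fun _ _ => Nat.zero_le _) (Finset.mem_univ i))
    · rw [notMem_support_iff.mp hd]; simp
  refine ⟨c0 + P + 1 + E, ?_⟩
  set c := c0 + P + 1 + E with hc
  intro W s
  induction s with
  | zero =>
    intro B hB _ w g _ _ hg _
    have : B = ∅ := Finset.card_eq_zero.mp hB
    rw [this, Finset.subset_empty, support_eq_empty] at hg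
    exact ⟨fun _ => 0, by simp [hg], by simp [nrm_zero]⟩
  | succ s ih =>
    intro B hB hlow w g hW hgI hgB hgw
    obtain ⟨u, huB, humax⟩ := B.exists_max_image (fun d => MonomialOrder.degLex.toSyn d)
      (Finset.card_pos.mp (by omega))
    set T : Finset ι := Finset.univ.filter (fun i => v i ≤ u) with hT
    have hmem := hlead g hgI u (fun d hd => humax d (hgB hd))
    have hTe : (fun i => if v i ≤ u then (p i).coeff (v i) else 0) =
        (fun i => if i ∈ T then (p i).coeff (v i) else 0) := by
      funext i; simp [hT]
    rw [hTe] at hmem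
    obtain ⟨h, hh, hhd, hhn⟩ := hcT T w _ hmem (hgw u)
    set G := fun i => if v i ≤ u then monomial (u - v i) (h i) else 0 with hG
    set g' := g - ∑ i, G i * p i with hg'
    have hGn : ∑ i, nrm pn (G i) ≤ (W + 2) ^ c0 * nrm pn g := by
      calc ∑ i, nrm pn (G i) ≤ ∑ i, pn (h i) := by
            refine Finset.sum_le_sum fun i _ => ?_
            simp only [hG]
            split_ifs
            · rw [nrm_monomial isNu_pn]
            · rw [nrm_zero]; exact Nat.zero_le _
        _ ≤ (w + 2) ^ cT T * pn (g.coeff u) := hhn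
        _ ≤ _ := by
            refine Nat.mul_le_mul ?_ (nrm_coeff_le isNu_pn g u)
            exact (Nat.pow_le_pow_right (by omega) (hc0 T)).trans
              (Nat.pow_le_pow_left (by have := Nat.zero_le ((s + 1) * c); omega) _)
    have hGp : nrm pn (∑ i, G i * p i) ≤ (W + 2) ^ c0 * nrm pn g * P := by
      refine (nrm_sum isNu_pn _ _).trans ?_
      calc _ ≤ ∑ i, nrm pn (G i) * P := Finset.sum_le_sum fun i _ =>
            (nrm_mul isNu_pn _ _).trans (Nat.mul_le_mul_left _ (hP i))
        _ = (∑ i, nrm pn (G i)) * P := by rw [Finset.sum_mul]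
        _ ≤ _ := Nat.mul_le_mul_right _ hGn
    have hcoef : ∀ i d, (G i * p i).coeff d =
        if v i ≤ u ∧ u - v i ≤ d then h i * (p i).coeff (d - (u - v i)) else 0 := by
      intro i d
      simp only [hG]
      by_cases h1 : v i ≤ u
      · simp only [h1, if_true, true_and]
        rw [coeff_monomial_mul']
      · simp [h1]
    have hcu : (∑ i, G i * p i).coeff u = g.coeff u := by
      rw [coeff_sum, hh]
      refine Finset.sum_congr rfl fun i _ => ?_
      rw [hcoef]
      by_cases h1 : v i ≤ u
      · simp [h1, hT, tsub_tsub_cancel_of_le h1]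
      · simp [h1, hT]
    have hsupp : ∀ d, (∑ i, G i * p i).coeff d ≠ 0 →
        MonomialOrder.degLex.toSyn d ≤ MonomialOrder.degLex.toSyn u := by
      intro d hd
      rw [coeff_sum] at hd
      obtain ⟨i, -, hi⟩ := Finset.exists_ne_zero_of_sum_ne_zero hd
      rw [hcoef] at hi
      split_ifs at hi with h1
      · have h2 : (p i).coeff (d - (u - v i)) ≠ 0 := right_ne_zero_of_mul hi
        have h3 := (hp i).2 _ (mem_support_iff.mpr h2)
        have e1 : d = (d - (u - v i)) + (u - v i) := (tsub_add_cancel_of_le h1.2).symm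
        have e2 : u = v i + (u - v i) := (add_tsub_cancel_of_le h1.1).symm
        rw [e1]
        conv_rhs => rw [e2]
        rw [map_add, map_add]
        exact add_le_add_left h3 _
      · exact absurd rfl hi
    have hg'I : g' ∈ I := I.sub_mem hgI (I.sum_mem fun i _ => I.mul_mem_left _ (hp i).1)
    have hg'B : g'.support ⊆ B.erase u := by
      intro d hd
      rw [mem_support_iff] at hd
      have hdu : d ≠ u := by
        rintro rfl
        rw [hg', coeff_sub, hcu, sub_self] at hd
        exact hd rfl
      rw [Finset.mem_erase]
      refine ⟨hdu, ?_⟩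
      by_cases h1 : g.coeff d = 0
      · rw [hg', coeff_sub, h1, zero_sub, neg_ne_zero] at hd
        exact hlow u huB d (hsupp d hd)
      · exact hgB (mem_support_iff.mpr h1)
    have hg'w : ∀ d, (g'.coeff d).natDegree ≤ w + c := by
      intro d
      rw [hg', coeff_sub]
      refine (Polynomial.natDegree_sub_le _ _).trans (max_le ((hgw d).trans (by omega)) ?_)
      rw [coeff_sum]
      refine Polynomial.natDegree_sum_le_of_forall_le _ _ fun i _ => ?_
      rw [hcoef]
      split_ifs
      · refine Polynomial.natDegree_mul_le.trans ?_
        have h1 := hhd i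
        have h2 := hc0 T
        have h3 := hE i (d - (u - v i))
        omega
      · simp
    have hBe : (B.erase u).card = s := by rw [Finset.card_erase_of_mem huB]; omega
    have hlow' : ∀ x ∈ B.erase u, ∀ d, MonomialOrder.degLex.toSyn d ≤ MonomialOrder.degLex.toSyn x →
        d ∈ B.erase u := by
      intro x hx d hd
      rw [Finset.mem_erase] at hx ⊢
      refine ⟨?_, hlow x hx.2 d hd⟩
      rintro rfl
      exact hx.1 (MonomialOrder.degLex.toSyn.injective (le_antisymm (humax x hx.2) hd))
    obtain ⟨H, hH, hHn⟩ := ih (B.erase u) hBe hlow' (w + c) g' (by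
      have : (s + 1) * c = s * c + c := by ring
      omega) hg'I hg'B hg'w
    refine ⟨fun i => G i + H i, ?_, ?_⟩
    · simp only [add_mul, Finset.sum_add_distrib, ← hH]
      rw [hg']; ring
    · have hn' : nrm pn g' ≤ nrm pn g + (W + 2) ^ c0 * nrm pn g * P := by
        rw [hg', sub_eq_add_neg]
        refine (nrm_add isNu_pn _ _).trans ?_
        rw [nrm_neg isNu_pn]
        omega
      set N := nrm pn g
      set Q := 1 + (W + 2) ^ c * c with hQ
      have hQ1 : 1 ≤ Q ^ s := Nat.one_le_pow _ _ (by omega)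
      have hpw : (W + 2) ^ c0 ≤ (W + 2) ^ c := Nat.pow_le_pow_right (by omega) (by omega)
      have hcP : P + 1 ≤ c := by omega
      calc ∑ i, nrm pn (G i + H i) ≤ ∑ i, nrm pn (G i) + ∑ i, nrm pn (H i) := by
            rw [← Finset.sum_add_distrib]
            exact Finset.sum_le_sum fun i _ => nrm_add isNu_pn _ _
        _ ≤ (W + 2) ^ c0 * N + Q ^ s * (N + (W + 2) ^ c0 * N * P) :=
            add_le_add hGn (hHn.trans (Nat.mul_le_mul_left _ hn'))
        _ ≤ Q ^ s * ((W + 2) ^ c0 * N) + Q ^ s * (N + (W + 2) ^ c0 * N * P) := by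
            exact Nat.add_le_add_right (Nat.le_mul_of_pos_left _ hQ1) _
        _ = Q ^ s * (1 + (W + 2) ^ c0 * (P + 1)) * N := by ring
        _ ≤ Q ^ s * Q * N := by
            refine Nat.mul_le_mul_right _ (Nat.mul_le_mul_left _ ?_)
            rw [hQ]
            exact Nat.add_le_add_left (Nat.mul_le_mul hpw hcP) _
        _ = _ := by rw [pow_succ]

end Main
section Final
open MvPolynomial

noncomputable def psi (k : ℕ) : MvPolynomial (Fin (k + 1)) ℤ →ₐ[ℤ] MvPolynomial (Fin k) (Polynomial ℤ) :=
  aeval (Fin.cons (C Polynomial.X) X)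

noncomputable def chi (k : ℕ) : MvPolynomial (Fin k) (Polynomial ℤ) →+* MvPolynomial (Fin (k + 1)) ℤ :=
  eval₂Hom (Polynomial.aeval (X 0 : MvPolynomial (Fin (k + 1)) ℤ)).toRingHom (fun j => X j.succ)

theorem chi_psi (k : ℕ) (g : MvPolynomial (Fin (k + 1)) ℤ) : chi k (psi k g) = g := by
  induction g using MvPolynomial.induction_on with
  | C a => simp [psi, chi]
  | add p q hp hq => rw [map_add, map_add, hp, hq]
  | mul_X p i hp =>
    rw [map_mul, map_mul, hp]
    congr 1
    refine Fin.cases ?_ (fun j => ?_) i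
    · simp [psi, chi]
    · simp [psi, chi]

theorem psi_monomial (k : ℕ) (d : Fin (k + 1) →₀ ℕ) (z : ℤ) :
    psi k (monomial d z) = monomial d.tail (Polynomial.monomial (d 0) z) := by
  rw [psi, aeval_monomial, Finsupp.prod_fintype _ _ (by simp), Fin.prod_univ_succ]
  simp only [Fin.cons_zero, Fin.cons_succ]
  rw [monomial_eq (s := d.tail), Finsupp.prod_fintype _ _ (by simp),
    ← Polynomial.C_mul_X_pow_eq_monomial, map_mul, map_pow, mul_assoc]
  congr 1

theorem psi_eq_sum (k : ℕ) (g : MvPolynomial (Fin (k + 1)) ℤ) :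
    psi k g = ∑ d ∈ g.support, monomial d.tail (Polynomial.monomial (d 0) (g.coeff d)) := by
  conv_lhs => rw [g.as_sum, map_sum]
  exact Finset.sum_congr rfl fun d _ => psi_monomial _ _ _

theorem psi_norm (k : ℕ) (g : MvPolynomial (Fin (k + 1)) ℤ) : nrm pn (psi k g) ≤ mnorm g := by
  rw [psi_eq_sum]
  refine (nrm_sum isNu_pn _ _).trans ?_
  refine Finset.sum_le_sum fun d _ => ?_
  rw [nrm_monomial isNu_pn, pn_monomial]

theorem tail_degree {k : ℕ} (d : Fin (k + 1) →₀ ℕ) :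
    d 0 + d.tail.degree = d.sum (fun _ e => e) := by
  rw [Finsupp.degree_eq_sum, Finsupp.sum_fintype _ _ (by simp), Fin.sum_univ_succ]
  rfl

theorem psi_degree (k n : ℕ) (g : MvPolynomial (Fin (k + 1)) ℤ) (hg : g.totalDegree ≤ n) (d) :
    ((psi k g).coeff d).natDegree ≤ n := by
  classical
  rw [psi_eq_sum, coeff_sum]
  refine Polynomial.natDegree_sum_le_of_forall_le _ _ fun e he => ?_
  rw [coeff_monomial]
  split_ifs
  · refine (Polynomial.natDegree_monomial_le _).trans ?_
    have h1 := le_totalDegree he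
    have := tail_degree e
    omega
  · simp

theorem psi_support (k n : ℕ) (g : MvPolynomial (Fin (k + 1)) ℤ) (hg : g.totalDegree ≤ n) (d)
    (hd : d ∈ (psi k g).support) : d.degree ≤ n := by
  classical
  rw [mem_support_iff, psi_eq_sum, coeff_sum] at hd
  obtain ⟨e, he, h⟩ := Finset.exists_ne_zero_of_sum_ne_zero hd
  rw [coeff_monomial] at h
  split_ifs at h with h1
  · have h2 := le_totalDegree he
    have := tail_degree e
    rw [← h1]
    omega
  · exact absurd rfl h

theorem chi_norm (k : ℕ) (H : MvPolynomial (Fin k) (Polynomial ℤ)) : mnorm (chi k H) ≤ nrm pn H := by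
  conv_lhs => rw [H.as_sum, map_sum, mnorm_eq]
  refine (nrm_sum isNu_int _ _).trans ?_
  refine Finset.sum_le_sum fun v _ => ?_
  set h := H.coeff v
  conv_lhs => rw [h.as_sum_support, map_sum, map_sum]
  refine (nrm_sum isNu_int _ _).trans ?_
  refine Finset.sum_le_sum fun i _ => ?_
  have : monomial v (Polynomial.monomial i (h.coeff i)) =
      psi k (monomial (Finsupp.cons i v) (h.coeff i)) := by
    rw [psi_monomial, Finsupp.tail_cons, Finsupp.cons_zero]
  rw [this, chi_psi, nrm_monomial isNu_int]

theorem marea_le {k s : ℕ} (F : Fin s → MvPolynomial (Fin k) ℤ) (g : MvPolynomial (Fin k) ℤ)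
    (h : Fin s → MvPolynomial (Fin k) ℤ) (hg : g = ∑ i, h i * F i) :
    marea F g ≤ ∑ i, mnorm (h i) := Nat.sInf_le ⟨h, hg, rfl⟩

theorem exists_box (k n : ℕ) : ∃ B : Finset (Fin k →₀ ℕ), B.card ≤ (n + 1) ^ k ∧
    ∀ d, d ∈ B ↔ d.degree ≤ n := by
  classical
  let f : Fin k →₀ ℕ := Finsupp.equivFunOnFinite.symm (fun _ => n)
  refine ⟨(Finset.Iic f).filter (fun d => d.degree ≤ n), ?_, fun d => ?_⟩
  · refine (Finset.card_filter_le _ _).trans ?_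
    rw [Finsupp.card_Iic]
    calc _ ≤ ∏ i ∈ f.support, (n + 1) := by
          refine Finset.prod_le_prod' fun i _ => ?_
          simp [f]
      _ ≤ _ := by
          rw [Finset.prod_const]
          exact Nat.pow_le_pow_right (by omega) ((Finset.card_le_univ _).trans (by simp))
  · rw [Finset.mem_filter, Finset.mem_Iic]
    refine ⟨fun h => h.2, fun h => ⟨fun i => ?_, h⟩⟩
    exact (Finsupp.le_degree i d).trans h

theorem crude {k s : ℕ} (F : Fin s → MvPolynomial (Fin (k + 1)) ℤ) :
    ∃ c D : ℕ, ∀ n g, g ∈ Ideal.span (Set.range F) → g.totalDegree ≤ n →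
      marea F g ≤ D * ((1 + (n + (n + 1) ^ k * c + 2) ^ c * c) ^ ((n + 1) ^ k) * mnorm g) := by
  classical
  set I := Ideal.span (Set.range F) with hI
  obtain ⟨ι, hι, p, hp, c, hc⟩ := main_alg (I.comap (chi k))
  have hb : ∀ i, ∃ b : Fin s → MvPolynomial (Fin (k + 1)) ℤ, ∑ j, b j * F j = chi k (p i) :=
    fun i => Ideal.mem_span_range_iff_exists_fun.mp (hp i)
  choose b hb using hb
  obtain ⟨D, hD⟩ : ∃ D, ∀ i, ∑ j, mnorm (b i j) ≤ D :=
    ⟨∑ i, ∑ j, mnorm (b i j), fun i => Finset.single_le_sum (f := fun i => ∑ j, mnorm (b i j))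
      (fun _ _ => Nat.zero_le _) (Finset.mem_univ i)⟩
  refine ⟨c, D, fun n g hg hgn => ?_⟩
  obtain ⟨B, hBc, hB⟩ := exists_box k n
  obtain ⟨H, hH, hHn⟩ := hc (n + (n + 1) ^ k * c) B.card B rfl (by
    intro u hu d hd
    rw [hB] at hu ⊢
    exact (Finsupp.DegLex.monotone_degree (MonomialOrder.degLex_le_iff.mp hd)).trans hu)
    n (psi k g) (by gcongr) (by rw [Ideal.mem_comap, chi_psi]; exact hg)
    (fun d hd => (hB d).mpr (psi_support k n g hgn d hd)) (psi_degree k n g hgn)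
  have e : g = ∑ j, (∑ i, chi k (H i) * b i j) * F j := by
    conv_lhs => rw [← chi_psi k g, hH, map_sum]
    simp only [map_mul, ← hb, Finset.mul_sum, Finset.sum_mul]
    rw [Finset.sum_comm]
    simp only [mul_assoc]
  refine (marea_le F g _ e).trans ?_
  calc ∑ j, mnorm (∑ i, chi k (H i) * b i j) ≤ ∑ j, ∑ i, mnorm (chi k (H i)) * mnorm (b i j) := by
        refine Finset.sum_le_sum fun j _ => ?_
        exact (nrm_sum isNu_int _ _).trans (Finset.sum_le_sum fun i _ => nrm_mul isNu_int _ _)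
    _ = ∑ i, mnorm (chi k (H i)) * ∑ j, mnorm (b i j) := by
        rw [Finset.sum_comm]; simp only [Finset.mul_sum]
    _ ≤ ∑ i, nrm pn (H i) * D :=
        Finset.sum_le_sum fun i _ => Nat.mul_le_mul (chi_norm k _) (hD i)
    _ = D * ∑ i, nrm pn (H i) := by rw [← Finset.sum_mul, mul_comm]
    _ ≤ _ := by
        refine Nat.mul_le_mul_left _ (hHn.trans ?_)
        exact Nat.mul_le_mul (Nat.pow_le_pow_right (by omega) hBc) (psi_norm k g)

theorem poly_exp (e : ℕ) : ∃ n0, ∀ n, n0 ≤ n → 2 * (n + 2) ^ e ≤ 2 ^ n := by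
  have h := tendsto_pow_const_div_const_pow_of_one_lt e (r := (2 : ℝ)) (by norm_num)
  have h1 := h.eventually (gt_mem_nhds (by norm_num : (0 : ℝ) < 1 / 8))
  obtain ⟨n0, hn0⟩ := Filter.eventually_atTop.mp h1
  refine ⟨n0, fun n hn => ?_⟩
  have h2 := hn0 (n + 2) (by omega)
  rw [div_lt_iff₀ (by positivity)] at h2
  have h3 : (2 : ℝ) * ((n : ℝ) + 2) ^ e ≤ 2 ^ n := by
    push_cast at h2
    rw [pow_add] at h2
    linarith
  exact_mod_cast h3

theorem num_bound (k c : ℕ) : ∃ C : ℕ, ∀ n, 1 ≤ n →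
    (1 + (n + (n + 1) ^ k * c + 2) ^ c * c) ^ ((n + 1) ^ k) ≤ C * 2 ^ (n ^ (k + 1) - 1) := by
  set f : ℕ → ℕ := fun n => (1 + (n + (n + 1) ^ k * c + 2) ^ c * c) ^ ((n + 1) ^ k) with hf
  set e0 := (k + 1 + c) * c + c with he0
  obtain ⟨n0, hn0⟩ := poly_exp (e0 * 2 ^ k)
  have hc2 : ∀ n : ℕ, c + 1 ≤ (n + 2) ^ c := fun n =>
    (Nat.lt_two_pow_self (n := c)).trans_le (Nat.pow_le_pow_left (by omega) _)
  have hQ : ∀ n : ℕ, 1 + (n + (n + 1) ^ k * c + 2) ^ c * c ≤ (n + 2) ^ e0 := by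
    intro n
    have h1 : n + (n + 1) ^ k * c + 2 ≤ (n + 2) ^ (k + 1 + c) := by
      have a1 : n + 2 ≤ (n + 2) ^ (k + 1) := Nat.le_self_pow (by omega) _
      have a2 : (n + 1) ^ k ≤ (n + 2) ^ (k + 1) :=
        (Nat.pow_le_pow_left (by omega) _).trans (Nat.pow_le_pow_right (by omega) (by omega))
      calc n + (n + 1) ^ k * c + 2 = (n + 2) + (n + 1) ^ k * c := by ring
        _ ≤ (n + 2) ^ (k + 1) + (n + 2) ^ (k + 1) * c := by gcongr
        _ = (n + 2) ^ (k + 1) * (c + 1) := by ring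
        _ ≤ (n + 2) ^ (k + 1) * (n + 2) ^ c := Nat.mul_le_mul_left _ (hc2 n)
        _ = _ := by rw [← pow_add]
    calc 1 + (n + (n + 1) ^ k * c + 2) ^ c * c ≤ 1 + ((n + 2) ^ (k + 1 + c)) ^ c * c := by gcongr
      _ ≤ ((n + 2) ^ (k + 1 + c)) ^ c + ((n + 2) ^ (k + 1 + c)) ^ c * c := by
          gcongr; exact Nat.one_le_pow _ _ (by positivity)
      _ = ((n + 2) ^ (k + 1 + c)) ^ c * (c + 1) := by ring
      _ ≤ ((n + 2) ^ (k + 1 + c)) ^ c * (n + 2) ^ c := Nat.mul_le_mul_left _ (hc2 n)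
      _ = _ := by rw [← pow_mul, ← pow_add]
  refine ⟨1 + ∑ n ∈ Finset.range n0, f n, fun n hn => ?_⟩
  change f n ≤ _
  by_cases h : n < n0
  · have h1 := Finset.single_le_sum (f := f) (fun _ _ => Nat.zero_le _) (Finset.mem_range.mpr h)
    calc f n ≤ 1 + ∑ n ∈ Finset.range n0, f n := by omega
      _ ≤ _ := Nat.le_mul_of_pos_right _ (by positivity)
  · have h2 := hn0 n (by omega)
    obtain ⟨t, rfl⟩ : ∃ t, n = t + 1 := ⟨n - 1, by omega⟩
    have h3 : (t + 1 + 2) ^ (e0 * 2 ^ k) ≤ 2 ^ t := by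
      rw [pow_succ] at h2; omega
    have hk1 : 1 ≤ (t + 1) ^ k := Nat.one_le_pow _ _ (by omega)
    calc f (t + 1) ≤ ((t + 1 + 2) ^ e0) ^ ((t + 1 + 1) ^ k) := Nat.pow_le_pow_left (hQ _) _
      _ ≤ ((t + 1 + 2) ^ e0) ^ ((2 * (t + 1)) ^ k) := by
          refine Nat.pow_le_pow_right (by positivity) (Nat.pow_le_pow_left (by omega) _)
      _ = ((t + 1 + 2) ^ (e0 * 2 ^ k)) ^ ((t + 1) ^ k) := by
          rw [mul_pow, ← pow_mul, ← pow_mul, mul_assoc]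
      _ ≤ (2 ^ t) ^ ((t + 1) ^ k) := Nat.pow_le_pow_left h3 _
      _ = 2 ^ (t * (t + 1) ^ k) := by rw [← pow_mul]
      _ ≤ 2 ^ ((t + 1) ^ (k + 1) - 1) := by
          refine Nat.pow_le_pow_right (by omega) ?_
          have : (t + 1) ^ (k + 1) = t * (t + 1) ^ k + (t + 1) ^ k := by ring
          omega
      _ ≤ _ := Nat.le_mul_of_pos_left _ (by omega)

theorem mono_bound {k s : ℕ} (F : Fin s → MvPolynomial (Fin k) ℤ) :
    ∃ C : ℕ, ∀ g ∈ Ideal.span (Set.range F), mnorm g ≤ 1 → marea F g ≤ C := by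
  classical
  set I := Ideal.span (Set.range F) with hI
  let S : Set (Fin k →₀ ℕ) := {d | monomial d (1 : ℤ) ∈ I}
  obtain ⟨T', hT', hspan⟩ := (Submodule.fg_span_iff_fg_span_finset_subset
    ((fun d => monomial d (1 : ℤ)) '' S)).mp
    (IsNoetherian.noetherian (Submodule.span (MvPolynomial (Fin k) ℤ) _))
  obtain ⟨T, hTS, rfl⟩ := Finset.subset_set_image_iff.mp hT'
  have hrep : ∀ d, ∃ h : Fin s → MvPolynomial (Fin k) ℤ, d ∈ S →
      ∑ i, h i * F i = monomial d (1 : ℤ) := by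
    intro d
    by_cases hd : d ∈ S
    · obtain ⟨h, hh⟩ := Ideal.mem_span_range_iff_exists_fun.mp hd
      exact ⟨h, fun _ => hh⟩
    · exact ⟨0, fun h => absurd h hd⟩
  choose h hh using hrep
  refine ⟨∑ d ∈ T, ∑ i, mnorm (h d i), fun g hg hg1 => ?_⟩
  by_cases hg0 : g = 0
  · have := marea_le F g (fun _ => 0) (by simp [hg0])
    have h0 : mnorm (0 : MvPolynomial (Fin k) ℤ) = 0 := nrm_zero _
    simp [h0] at this
    omega
  obtain ⟨d, hd⟩ := Finset.nonempty_iff_ne_empty.mpr (fun hh => hg0 (support_eq_empty.mp hh))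
  have hsplit : mnorm g = (g.coeff d).natAbs + ∑ e ∈ g.support.erase d, (g.coeff e).natAbs := by
    rw [mnorm, ← Finset.add_sum_erase _ _ hd]
  have hd' : g.coeff d ≠ 0 := mem_support_iff.mp hd
  have hsum : ∑ e ∈ g.support.erase d, (g.coeff e).natAbs = 0 := by omega
  have hge : g = monomial d (g.coeff d) := by
    ext e
    rw [coeff_monomial]
    split_ifs with h1
    · rw [h1]
    · by_contra h2
      have := (Finset.sum_eq_zero_iff.mp hsum) e
        (Finset.mem_erase.mpr ⟨fun h => h1 h.symm, mem_support_iff.mpr h2⟩)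
      exact h2 (Int.natAbs_eq_zero.mp this)
  have hc1 : (g.coeff d).natAbs = 1 := by omega
  have hcc : g.coeff d * g.coeff d = 1 := by
    rcases Int.natAbs_eq (g.coeff d) with h | h <;> rw [h, hc1] <;> norm_num
  have hdS : d ∈ S := by
    have : monomial d (1 : ℤ) = C (g.coeff d) * g := by
      conv_rhs => rw [hge]
      rw [C_mul_monomial, coeff_monomial, if_pos rfl, hcc]
    change monomial d (1 : ℤ) ∈ I
    rw [this]
    exact I.mul_mem_left _ hg
  have hmem : monomial d (1 : ℤ) ∈ Ideal.span ((fun d => monomial d (1 : ℤ)) ''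
      (T : Set (Fin k →₀ ℕ))) := by
    have h1 : monomial d (1 : ℤ) ∈ Submodule.span (MvPolynomial (Fin k) ℤ)
      ((fun d => monomial d (1 : ℤ)) '' S) := Submodule.subset_span ⟨d, hdS, rfl⟩
    rw [hspan, Finset.coe_image] at h1
    exact h1
  obtain ⟨t, htT, htd⟩ := mem_ideal_span_monomial_image.mp hmem d (by simp)
  have e : g = ∑ i, (monomial (d - t) (g.coeff d) * h t i) * F i := by
    simp only [mul_assoc]
    rw [← Finset.mul_sum, hh t (hTS htT), monomial_mul, tsub_add_cancel_of_le htd, mul_one]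
    exact hge
  refine (marea_le F g _ e).trans ?_
  calc _ ≤ ∑ i, mnorm (h t i) := by
        refine Finset.sum_le_sum fun i _ => (nrm_monomial_mul isNu_int _ _ _).trans ?_
        rw [hc1, one_mul]; rfl
    _ ≤ _ := Finset.single_le_sum (f := fun d => ∑ i, mnorm (h d i)) (fun _ _ => Nat.zero_le _) htT

theorem zero_case {s : ℕ} (F : Fin s → MvPolynomial (Fin 0) ℤ) :
    ∃ D : ℕ, ∀ g ∈ Ideal.span (Set.range F), marea F g ≤ D * mnorm g := by
  set I := Ideal.span (Set.range F) with hI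
  obtain ⟨z0, hz0⟩ := (IsPrincipalIdealRing.principal (I.comap (C : ℤ →+* MvPolynomial (Fin 0) ℤ))).principal
  have h0 : C z0 ∈ I := by
    have : z0 ∈ I.comap (C : ℤ →+* MvPolynomial (Fin 0) ℤ) := by
      rw [hz0]; exact Submodule.mem_span_singleton_self z0
    exact this
  obtain ⟨h, hh⟩ := Ideal.mem_span_range_iff_exists_fun.mp h0
  refine ⟨∑ i, mnorm (h i), fun g hg => ?_⟩
  obtain ⟨z, rfl⟩ : ∃ z, g = C z := ⟨_, eq_C_of_isEmpty g⟩
  have hz : z ∈ I.comap (C : ℤ →+* MvPolynomial (Fin 0) ℤ) := hg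
  rw [hz0] at hz
  obtain ⟨q, hq⟩ := Submodule.mem_span_singleton.mp hz
  rw [smul_eq_mul] at hq
  have hn : ∀ y : ℤ, mnorm (C y : MvPolynomial (Fin 0) ℤ) = y.natAbs := fun y =>
    nrm_monomial isNu_int 0 y
  obtain ⟨q', hq', hle⟩ : ∃ q', q' * z0 = z ∧ q'.natAbs ≤ z.natAbs := by
    by_cases hz : z0 = 0
    · exact ⟨0, by rw [← hq, hz]; simp, by simp⟩
    · refine ⟨q, hq, ?_⟩
      rw [← hq, Int.natAbs_mul]
      exact Nat.le_mul_of_pos_right _ (Int.natAbs_pos.mpr hz)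
  have e : (C z : MvPolynomial (Fin 0) ℤ) = ∑ i, (C q' * h i) * F i := by
    simp only [mul_assoc]
    rw [← Finset.mul_sum, hh, ← hq', map_mul]
  refine (marea_le F _ _ e).trans ?_
  rw [hn, mul_comm, Finset.mul_sum]
  refine Finset.sum_le_sum fun i _ => (nrm_mul isNu_int _ _).trans ?_
  change mnorm (C q') * mnorm (h i) ≤ _
  rw [hn]
  gcongr

end Final

/-- For an ideal `I` of `ℤ[x₁,…,x_k]` with generating tuple `F`, there is a
constant `C > 0` such that every `g ∈ I` with `|g| ≤ m` and `deg g ≤ n` (for `m, n ≥ 1`)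
satisfies `area_{I,F}(g) ≤ C ⬝ m^(n^k)`. -/
theorem complexity_bound_polynomial {k s : ℕ} (F : Fin s → MvPolynomial (Fin k) ℤ)
    (I : Ideal (MvPolynomial (Fin k) ℤ)) (hI : I = Ideal.span (Set.range F)) :
    ∃ C : ℕ, 0 < C ∧
      ∀ m n : ℕ, 1 ≤ m → 1 ≤ n →
        ∀ g ∈ I, mnorm g ≤ m → g.totalDegree ≤ n →
          marea F g ≤ C * m ^ (n ^ k) := by
  subst hI
  cases k with
  | zero =>
    obtain ⟨D, hD⟩ := zero_case F
    refine ⟨D + 1, by omega, fun m n hm hn g hg hgm _ => (hD g hg).trans ?_⟩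
    rw [pow_zero, pow_one]
    gcongr
    omega
  | succ k =>
    obtain ⟨C1, hC1⟩ := mono_bound F
    obtain ⟨c, D, hcD⟩ := crude F
    obtain ⟨C2, hC2⟩ := num_bound k c
    refine ⟨C1 + D * C2 + 1, by omega, fun m n hm hn g hg hgm hgn => ?_⟩
    rcases Nat.lt_or_ge m 2 with h | h
    · have : m = 1 := by omega
      subst this
      rw [one_pow, mul_one]
      exact (hC1 g hg hgm).trans (by have := Nat.zero_le (D * C2); omega)
    · have hpos : 1 ≤ n ^ (k + 1) := Nat.one_le_pow _ _ hn
      calc marea F g ≤ D * ((1 + (n + (n + 1) ^ k * c + 2) ^ c * c) ^ ((n + 1) ^ k) * mnorm g) :=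
            hcD n g hg hgn
        _ ≤ D * ((C2 * m ^ (n ^ (k + 1) - 1)) * m) := by
            refine Nat.mul_le_mul_left _ (Nat.mul_le_mul ((hC2 n hn).trans ?_) hgm)
            exact Nat.mul_le_mul_left _ (Nat.pow_le_pow_left h _)
        _ = D * C2 * m ^ (n ^ (k + 1)) := by
            conv_rhs => rw [← Nat.sub_add_cancel hpos, pow_succ]
            ring
        _ ≤ _ := by gcongr; omega
end
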